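/- Let S be a Steiner tree (a shortest connected set containing a finite set C of points in the plane). If x is a point of S of degree 3 (three tangent directions), then locally near x the set S is a union of three segments meeting at x with pairwise angles exactly 2π/3. -/

import Mathlib

open MeasureTheory

/-- `d` is a tangent direction of `S` at `x`: a unit vector obtained as a limit
of normalized directions towards points of `S` approaching `x`. -/
def IsTangentDir (S : Set ℂ) (x d : ℂ) : Prop :=
  ‖d‖ = 1 ∧ ∃ f : ℕ → ℂ, (∀ n, f n ∈ S ∧ f n ≠ x) ∧
    Filter.Tendsto f Filter.atTop (nhds x) ∧
    Filter.Tendsto (fun n => ‖f n - x‖⁻¹ • (f n - x)) Filter.atTop (nhds d)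


lemma st_image {f : ℂ → ℝ} (hf : LipschitzWith 1 f) (A : Set ℂ) :
    volume (f '' A) ≤ μH[1] A := by
  have := hf.hausdorffMeasure_image_le (d := 1) zero_le_one A
  simpa [hausdorffMeasure_real] using this

lemma st_single (x : ℂ) : μH[1] ({x} : Set ℂ) = 0 := by
  have := MeasureTheory.Measure.nullSingletonClass_hausdorff ℂ (d := 1) one_pos
  exact measure_singleton x

lemma st_seg (x y : ℂ) : μH[1] (segment ℝ x y) = ENNReal.ofReal (dist x y) := by
  rw [hausdorffMeasure_segment, edist_dist]

lemma st_conn_ball {K : Set ℂ} (hK : IsPreconnected K) {q p : ℂ} (hq : q ∈ K) (hp : p ∈ K)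
    {τ : ℝ} (h : τ ≤ dist p q) : ENNReal.ofReal τ ≤ μH[1] (K ∩ Metric.ball q τ) := by
  have hl : LipschitzWith 1 (fun z : ℂ => dist z q) := LipschitzWith.dist_left q
  refine le_trans ?_ (st_image hl _)
  have : ENNReal.ofReal τ = volume (Set.Ico 0 τ) := by simp
  rw [this]
  apply measure_mono
  intro t ht
  have := (hK.image _ hl.continuous.continuousOn).Icc_subset (Set.mem_image_of_mem _ hq)
    (Set.mem_image_of_mem _ hp)
  obtain ⟨z, hz, hzt⟩ := this (a := t) ⟨by simpa using ht.1, ht.2.le.trans h⟩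
  exact ⟨z, ⟨hz, by simp only [Metric.mem_ball]; simp only at hzt; rw [hzt]; exact ht.2⟩, hzt⟩

lemma st_conn {K : Set ℂ} (hK : IsPreconnected K) {q p : ℂ} (hq : q ∈ K) (hp : p ∈ K) :
    ENNReal.ofReal (dist p q) ≤ μH[1] K :=
  (st_conn_ball hK hq hp le_rfl).trans (measure_mono Set.inter_subset_left)

/-- A connected set of length at most the distance of two of its points is the segment. -/
lemma st_segment_sub {K : Set ℂ} (hK : IsPreconnected K) {x p : ℂ} (hx : x ∈ K) (hp : p ∈ K)
    (h : μH[1] K ≤ ENNReal.ofReal (dist x p)) : K ⊆ segment ℝ x p := by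
  intro q hq
  by_contra hns
  have hlt : dist x p < dist x q + dist q p := by
    refine lt_of_le_of_ne (dist_triangle _ _ _) ?_
    intro he
    exact hns (mem_segment_iff_wbtw.2 (dist_add_dist_eq_iff.1 he.symm))
  obtain ⟨c, hc1, hc2⟩ : ∃ c, dist x p - dist q p < c ∧ c < dist q x := by
    apply exists_between; rw [dist_comm q x]; linarith
  have hf : LipschitzWith 1 (fun z : ℂ => dist z x) := LipschitzWith.dist_left x
  have hg : LipschitzWith 1 (fun z : ℂ => dist x p - dist z p) := by
    refine LipschitzWith.of_le_add fun y z => ?_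
    have := dist_triangle z y p
    rw [dist_comm z y] at this
    linarith
  obtain ⟨φ, hφd⟩ : ∃ φ : ℂ → ℝ, ∀ z, φ z = max (dist x p - dist z p) (min (dist z x) c) :=
    ⟨_, fun z => rfl⟩
  have hφ : LipschitzWith 1 φ := by
    have := hg.max (hf.min_const c)
    rw [max_self] at this
    rwa [show φ = _ from funext hφd]
  have hφx : φ x = 0 := by simp [hφd]
  have hφp : dist x p ≤ φ p := by rw [hφd]; simp
  have hev : ∀ᶠ z in nhds q, φ z = c := by
    have h1 : ∀ᶠ z in nhds q, c < dist z x :=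
      hf.continuous.continuousAt.eventually (lt_mem_nhds hc2)
    have h2 : ∀ᶠ z in nhds q, dist x p - dist z p < c :=
      hg.continuous.continuousAt.eventually (gt_mem_nhds hc1)
    filter_upwards [h1, h2] with z a b
    rw [hφd, min_eq_right a.le, max_eq_right b.le]
  obtain ⟨η, hη, hball⟩ := Metric.eventually_nhds_iff.1 hev
  have hqx : 0 < dist x q := by
    rw [dist_pos]; rintro rfl; exact hns (left_mem_segment ℝ _ _)
  have hτ : 0 < min η (dist x q) := lt_min hη hqx
  have hA := st_conn_ball hK hq hx (min_le_right η (dist x q))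
  set B := Metric.ball q (min η (dist x q)) with hB
  have hD : ENNReal.ofReal (dist x p) ≤ μH[1] (K \ B) := by
    refine le_trans ?_ (st_image hφ _)
    have : ENNReal.ofReal (dist x p) = volume (Set.Icc 0 (dist x p) \ {c}) := by
      rw [measure_sdiff_null (by simp)]; simp
    rw [this]
    apply measure_mono
    rintro t ⟨ht, htc⟩
    have := (hK.image _ hφ.continuous.continuousOn).Icc_subset (Set.mem_image_of_mem _ hx)
      (Set.mem_image_of_mem _ hp)
    obtain ⟨z, hz, hzt⟩ := this (a := t) ⟨by rw [hφx]; exact ht.1, ht.2.trans hφp⟩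
    refine ⟨z, ⟨hz, fun hzB => htc ?_⟩, hzt⟩
    rw [← hzt]
    exact hball (lt_of_lt_of_le (Metric.mem_ball.1 hzB) (min_le_left _ _))
  have hs := measure_inter_add_sdiff (μ := (μH[1] : Measure ℂ)) K (Metric.isOpen_ball (x := q) (ε := min η (dist x q))).measurableSet
  rw [← hB] at hs
  have : ENNReal.ofReal (min η (dist x q)) + ENNReal.ofReal (dist x p) ≤ ENNReal.ofReal (dist x p) :=
    (add_le_add hA hD).trans (hs.le.trans h)
  rw [← ENNReal.ofReal_add hτ.le dist_nonneg, ENNReal.ofReal_le_ofReal_iff dist_nonneg] at this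
  linarith

lemma st_segment {K : Set ℂ} (hK : IsPreconnected K) {x p : ℂ} (hx : x ∈ K) (hp : p ∈ K)
    (h : μH[1] K ≤ ENNReal.ofReal (dist x p)) : K = segment ℝ x p := by
  have hsub := st_segment_sub hK hx hp h
  refine hsub.antisymm ?_
  intro y hy
  have hl : LipschitzWith 1 (fun z : ℂ => dist z x) := LipschitzWith.dist_left x
  have := (hK.image _ hl.continuous.continuousOn).Icc_subset (Set.mem_image_of_mem _ hx)
    (Set.mem_image_of_mem _ hp)
  have hyd := dist_add_dist_of_mem_segment hy
  obtain ⟨z, hz, hzt⟩ := this (a := dist y x) ⟨by simp, by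
    change dist y x ≤ dist p x; rw [dist_comm y, dist_comm p]; linarith [dist_nonneg (x := y) (y := p)]⟩
  have hzs := hsub hz
  have : z = y := by
    rw [segment_eq_image'] at hzs hy
    obtain ⟨a, ha, rfl⟩ := hzs
    obtain ⟨b, hb, rfl⟩ := hy
    simp only [dist_eq_norm, add_sub_cancel_left, norm_smul, Real.norm_eq_abs, abs_of_nonneg ha.1,
      abs_of_nonneg hb.1] at hzt
    by_cases hpx : p - x = 0
    · simp [hpx]
    · have := mul_right_cancel₀ (norm_ne_zero_iff.2 hpx) hzt
      rw [this]
  exact this ▸ hz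

/-- Gluing. -/
lemma st_glue {S P Q T : Set ℂ} (hS : IsPreconnected S) (hPQ : S = P ∪ Q) (hP : IsClosed P)
    (hQ : IsClosed Q) (hT : IsClosed T) (hTc : IsPreconnected T) (hQne : Q.Nonempty)
    (hi : P ∩ Q ⊆ T) : IsPreconnected (P ∪ T) := by
  have key : ∀ u v : Set ℂ, IsClosed u → IsClosed v → P ∪ T ⊆ u ∪ v → Disjoint u v → T ⊆ u →
      P ∪ T ⊆ u := by
    intro u v hu hv huv hd hTu
    have hdj := Set.disjoint_left.1 hd
    have hSc : IsClosed S := hPQ ▸ hP.union hQ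
    have := (isPreconnected_iff_subset_of_fully_disjoint_closed hSc).1 hS (P ∩ v) ((P ∩ u) ∪ Q)
      (hP.inter hv) ((hP.inter hu).union hQ) (by
        intro z hz
        rw [hPQ] at hz
        rcases hz with hz | hz
        · rcases huv (Or.inl hz) with h | h
          · exact Or.inr (Or.inl ⟨hz, h⟩)
          · exact Or.inl ⟨hz, h⟩
        · exact Or.inr (Or.inr hz)) (by
        rw [Set.disjoint_left]
        rintro z ⟨hzP, hzv⟩ (⟨_, hzu⟩ | hzQ)
        · exact hdj hzu hzv
        · exact hdj (hTu (hi ⟨hzP, hzQ⟩)) hzv)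
    rcases this with h | h
    · obtain ⟨q, hq⟩ := hQne
      have hq' := h (hPQ.symm.subset (Or.inr hq))
      exact absurd hq'.2 (hdj (hTu (hi ⟨hq'.1, hq⟩)))
    · rintro z (hz | hz)
      · rcases h (hPQ.symm.subset (Or.inl hz)) with h' | h'
        · exact h'.2
        · exact hTu (hi ⟨hz, h'⟩)
      · exact hTu hz
  rw [isPreconnected_iff_subset_of_fully_disjoint_closed (hP.union hT)]
  intro u v hu hv huv hd
  rcases (isPreconnected_iff_subset_of_fully_disjoint_closed hT).1 hTc u v hu hv
    (Set.subset_union_right.trans huv) hd with h | h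
  · exact Or.inl (key u v hu hv huv hd h)
  · exact Or.inr (key v u hv hu (by rwa [Set.union_comm v]) hd.symm h)

/-- Pruning. -/
lemma st_prune {C S A R : Set ℂ} (hScon : IsPreconnected S)
    (hmin : ∀ S' : Set ℂ, IsClosed S' → IsConnected S' → C ⊆ S' →
      μH[1] S ≤ μH[1] S') (hfin : μH[1] S ≠ ⊤) {x : ℂ}
    (hA : IsClosed A) (hR : IsClosed R) (hS : S = A ∪ R) (hAR : A ∩ R = {x}) (hCR : C ⊆ R) :
    A ⊆ {x} := by
  have hx : x ∈ A ∩ R := hAR ▸ rfl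
  have hsx : ∀ {U : Set ℂ}, x ∈ U → U ∪ {x} = U := fun h => by simpa using h
  have hRc : IsPreconnected R := by
    have := st_glue hScon (hS.trans (Set.union_comm _ _)) hR hA isClosed_singleton
      isPreconnected_singleton ⟨x, hx.1⟩ (by rw [Set.inter_comm, hAR])
    rwa [hsx hx.2] at this
  have hAc : IsPreconnected A := by
    have := st_glue hScon hS hA hR isClosed_singleton
      isPreconnected_singleton ⟨x, hx.2⟩ hAR.le
    rwa [hsx hx.1] at this
  have h1 := hmin R hR ⟨⟨x, hx.2⟩, hRc⟩ hCR
  have h2 : μH[1] S = μH[1] R + μH[1] (A \ R) := by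
    rw [← measure_inter_add_sdiff S hR.measurableSet, hS, Set.union_inter_cancel_right,
      Set.union_sdiff_right]
  have hRf : μH[1] R ≠ ⊤ := ne_top_of_le_ne_top hfin (measure_mono (hS ▸ Set.subset_union_right))
  have h3 : μH[1] (A \ R) = 0 := by
    rw [h2] at h1
    have : μH[1] R + μH[1] (A \ R) ≤ μH[1] R + 0 := by simpa using h1
    simpa using (ENNReal.add_le_add_iff_left hRf).1 this
  have h4 : μH[1] A = 0 := by
    rw [← measure_inter_add_sdiff A hR.measurableSet, h3, hAR, st_single, add_zero]
  intro y hy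
  have := st_conn hAc hx.1 hy
  rw [h4] at this
  have : dist y x ≤ 0 := by simpa using this
  exact dist_le_zero.1 this

/-- Replacement. -/
lemma st_replace {C S T : Set ℂ} (hSc : IsClosed S) (hScon : IsPreconnected S) (hCS : C ⊆ S)
    (hmin : ∀ S' : Set ℂ, IsClosed S' → IsConnected S' → C ⊆ S' →
      μH[1] S ≤ μH[1] S') (hfin : μH[1] S ≠ ⊤) {x : ℂ} (hx : x ∈ S) {r : ℝ} (hr : 0 < r)
    (hT : IsClosed T) (hTc : IsConnected T) (hb : S ∩ Metric.sphere x r ⊆ T)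
    (hCT : C ∩ Metric.ball x r ⊆ T) : μH[1] (S ∩ Metric.closedBall x r) ≤ μH[1] T := by
  have hc : IsClosed (S \ Metric.ball x r) := hSc.sdiff Metric.isOpen_ball
  have h1 := st_glue (S := S) (P := S \ Metric.ball x r) (Q := S ∩ Metric.closedBall x r) (T := T)
    hScon (by
      ext z
      simp only [Set.mem_union, Set.mem_sdiff, Set.mem_inter_iff, Metric.mem_ball,
        Metric.mem_closedBall]
      by_cases h : dist z x < r
      · simp [h, h.le]
      · simp +contextual [h]) hc
    (hSc.inter Metric.isClosed_closedBall) hT hTc.2 ⟨x, hx, Metric.mem_closedBall_self hr.le⟩ (by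
      rintro z ⟨⟨hz, hz1⟩, _, hz2⟩
      exact hb ⟨hz, le_antisymm hz2 (not_lt.1 hz1)⟩)
  have h2 := hmin _ (hc.union hT) ⟨hTc.1.mono Set.subset_union_right, h1⟩ (by
    intro c hc
    by_cases h : c ∈ Metric.ball x r
    · exact Or.inr (hCT ⟨hc, h⟩)
    · exact Or.inl ⟨hCS hc, h⟩)
  have h3 : (S \ Metric.ball x r) ∪ T ⊆ (S \ Metric.closedBall x r) ∪ T := by
    rintro z (⟨hz, hz1⟩ | hz)
    · by_cases h : z ∈ Metric.closedBall x r
      · exact Or.inr (hb ⟨hz, le_antisymm h (not_lt.1 hz1)⟩)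
      · exact Or.inl ⟨hz, h⟩
    · exact Or.inr hz
  have h4 := h2.trans ((measure_mono h3).trans (measure_union_le _ _))
  rw [← measure_inter_add_sdiff S (Metric.isClosed_closedBall (x := x) (ε := r)).measurableSet, add_comm] at h4
  exact (ENNReal.add_le_add_iff_left
    (ne_top_of_le_ne_top hfin (measure_mono Set.sdiff_subset))).1 h4

/-- Multiplicity. -/
lemma st_mult {K : Set ℂ} (hK : IsCompact K) {f g : ℂ → ℝ} (hf : LipschitzWith 1 f)
    (hg : Continuous g) :
    volume (f '' K) + volume {t | ∃ z ∈ K, ∃ w ∈ K, f z = t ∧ f w = t ∧ g z < g w} ≤ μH[1] K := by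
  set N : Set ℂ := {z | z ∈ K ∧ ∃ w ∈ K, f w = f z ∧ g z < g w} with hN
  have hNm : MeasurableSet N := by
    have : N = ⋃ q : ℚ, (K ∩ {z | g z < q}) ∩ f ⁻¹' (f '' (K ∩ {z | (q : ℝ) ≤ g z})) := by
      ext z
      simp only [hN, Set.mem_ofPred_eq, Set.mem_iUnion, Set.mem_inter_iff, Set.mem_preimage,
        Set.mem_image]
      constructor
      · rintro ⟨hz, w, hw, hwz, hlt⟩
        obtain ⟨q, hq1, hq2⟩ := exists_rat_btwn hlt
        exact ⟨q, ⟨hz, hq1⟩, w, ⟨hw, hq2.le⟩, hwz⟩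
      · rintro ⟨q, ⟨hz, hq1⟩, w, ⟨hw, hq2⟩, hwz⟩
        exact ⟨hz, w, hw, hwz, hq1.trans_le hq2⟩
    rw [this]
    refine MeasurableSet.iUnion fun q => ?_
    refine (hK.isClosed.measurableSet.inter (isOpen_lt hg continuous_const).measurableSet).inter ?_
    exact (((hK.inter_right (isClosed_le continuous_const hg)).image
      hf.continuous).isClosed.preimage hf.continuous).measurableSet
  rw [← measure_inter_add_sdiff K hNm, add_comm]
  refine add_le_add (le_trans (measure_mono ?_) (st_image hf _))
    (le_trans (measure_mono ?_) (st_image hf _))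
  · rintro t ⟨z, hz, w, hw, rfl, hw2, hlt⟩
    exact ⟨z, ⟨hz, hz, w, hw, hw2, hlt⟩, rfl⟩
  · rintro t ⟨z, hz, rfl⟩
    obtain ⟨m, hm, hmax⟩ := (hK.inter_right (isClosed_singleton.preimage hf.continuous (t := {f z}))).exists_isMaxOn
      ⟨z, hz, rfl⟩ hg.continuousOn
    refine ⟨m, ⟨hm.1, ?_⟩, hm.2⟩
    rintro ⟨_, w, hw, hwm, hlt⟩
    exact absurd (hmax (a := w) ⟨hw, hwm.trans hm.2⟩) (not_le.2 hlt)

structure StCtx (C S : Set ℂ) (x : ℂ) (r : ℝ) (K : Fin 3 → Set ℂ) : Prop where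
  hSc : IsClosed S
  hcon : IsPreconnected S
  hCS : C ⊆ S
  hmin : ∀ S' : Set ℂ, IsClosed S' → IsConnected S' → C ⊆ S' → μH[1] S ≤ μH[1] S'
  hfin : μH[1] S ≠ ⊤
  hx : x ∈ S
  hK : ∀ i, IsClosed (K i)
  hxK : ∀ i, x ∈ K i
  hdisj : ∀ i j, i ≠ j → K i ∩ K j ⊆ {x}
  hcov : S ∩ Metric.closedBall x r ⊆ ⋃ i, K i
  hCr : C ∩ Metric.closedBall x r ⊆ {x}
  happ : ∀ i, ∀ ρ > 0, ∃ z ∈ S ∩ K i, z ≠ x ∧ dist z x < ρ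

namespace StCtx

variable {C S : Set ℂ} {x : ℂ} {r : ℝ} {K : Fin 3 → Set ℂ}

lemma prune (h : StCtx C S x r K) {ρ : ℝ} (_hρ : 0 < ρ) (hρr : ρ ≤ r) (i : Fin 3) {A B : Set ℂ}
    (hA : IsClosed A) (hB : IsClosed B) (hAB : A ∪ B = S ∩ Metric.closedBall x ρ ∩ K i)
    (hi : A ∩ B ⊆ {x}) (hxA : x ∈ A) (hs : ∀ z ∈ A, dist z x ≠ ρ) : A ⊆ {x} := by
  have hmono := Metric.closedBall_subset_closedBall (x := x) hρr
  have hAs : A ⊆ S ∩ Metric.closedBall x ρ ∩ K i := hAB ▸ Set.subset_union_left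
  have hBs : B ⊆ S ∩ Metric.closedBall x ρ ∩ K i := hAB ▸ Set.subset_union_right
  set R : Set ℂ := (S \ Metric.ball x ρ) ∪ (⋃ j, ⋃ (_ : j ≠ i), S ∩ Metric.closedBall x ρ ∩ K j) ∪
    {x} ∪ B with hR
  refine st_prune (R := R) h.hcon h.hmin h.hfin hA ?_ ?_ ?_ ?_
  · refine IsClosed.union (IsClosed.union (IsClosed.union (h.hSc.sdiff Metric.isOpen_ball) ?_)
      isClosed_singleton) hB
    refine isClosed_iUnion_of_finite fun j => isClosed_iUnion_of_finite fun _ => ?_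
    exact (h.hSc.inter Metric.isClosed_closedBall).inter (h.hK j)
  · apply Set.Subset.antisymm
    · intro z hz
      by_cases hzb : z ∈ Metric.ball x ρ
      · have hzc := Metric.ball_subset_closedBall hzb
        obtain ⟨j, hj⟩ := Set.mem_iUnion.1 (h.hcov ⟨hz, hmono hzc⟩)
        by_cases hji : j = i
        · subst hji
          rcases hAB.symm.subset ⟨⟨hz, hzc⟩, hj⟩ with h' | h'
          · exact Or.inl h'
          · exact Or.inr (Or.inr h')
        · refine Or.inr (Or.inl (Or.inl (Or.inr ?_)))
          exact Set.mem_iUnion.2 ⟨j, Set.mem_iUnion.2 ⟨hji, ⟨hz, hzc⟩, hj⟩⟩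
      · exact Or.inr (Or.inl (Or.inl (Or.inl ⟨hz, hzb⟩)))
    · rintro z (hz | ((hz | hz) | hz) | hz)
      · exact (hAs hz).1.1
      · exact hz.1
      · obtain ⟨j, hj⟩ := Set.mem_iUnion.1 hz
        obtain ⟨_, hj⟩ := Set.mem_iUnion.1 hj
        exact hj.1.1
      · rw [Set.mem_singleton_iff.1 hz]; exact h.hx
      · exact (hBs hz).1.1
  · apply Set.Subset.antisymm
    · rintro z ⟨hzA, ((hz | hz) | hz) | hz⟩
      · exact absurd (le_antisymm (hAs hzA).1.2 (not_lt.1 hz.2)) (hs z hzA)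
      · obtain ⟨j, hj⟩ := Set.mem_iUnion.1 hz
        obtain ⟨hji, hj⟩ := Set.mem_iUnion.1 hj
        exact h.hdisj j i hji ⟨hj.2, (hAs hzA).2⟩
      · exact hz
      · exact hi ⟨hzA, hz⟩
    · rintro z rfl
      exact ⟨hxA, Or.inl (Or.inr rfl)⟩
  · intro c hc
    by_cases hcb : c ∈ Metric.ball x ρ
    · exact Or.inl (Or.inr (h.hCr ⟨hc, hmono (Metric.ball_subset_closedBall hcb)⟩))
    · exact Or.inl (Or.inl (Or.inl ⟨h.hCS hc, hcb⟩))

lemma closedD (h : StCtx C S x r K) (ρ : ℝ) (i : Fin 3) :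
    IsClosed (S ∩ Metric.closedBall x ρ ∩ K i) :=
  (h.hSc.inter Metric.isClosed_closedBall).inter (h.hK i)

lemma xmem (h : StCtx C S x r K) {ρ : ℝ} (hρ : 0 < ρ) (i : Fin 3) :
    x ∈ S ∩ Metric.closedBall x ρ ∩ K i :=
  ⟨⟨h.hx, Metric.mem_closedBall_self hρ.le⟩, h.hxK i⟩

lemma meet (h : StCtx C S x r K) {ρ : ℝ} (hρ : 0 < ρ) (hρr : ρ ≤ r) (i : Fin 3) :
    ∃ z ∈ S ∩ K i, dist z x = ρ := by
  by_contra! hcon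
  have := h.prune hρ hρr i (A := S ∩ Metric.closedBall x ρ ∩ K i) (B := {x}) (h.closedD ρ i)
    isClosed_singleton (by simpa using h.xmem hρ i) Set.inter_subset_right (h.xmem hρ i)
    (fun z hz => hcon z ⟨hz.1.1, hz.2⟩)
  obtain ⟨z, hz, hne, hlt⟩ := h.happ i ρ hρ
  exact hne (this ⟨⟨hz.1, hlt.le⟩, hz.2⟩)

lemma preconn (h : StCtx C S x r K) {ρ : ℝ} (hρ : 0 < ρ) (hρr : ρ ≤ r) (i : Fin 3) {p : ℂ}
    (hp : ∀ z ∈ S ∩ K i, dist z x = ρ → z = p) :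
    IsPreconnected (S ∩ Metric.closedBall x ρ ∩ K i) := by
  have hDc := h.closedD ρ i
  have hxD := h.xmem hρ i
  set D := S ∩ Metric.closedBall x ρ ∩ K i with hD
  have key : ∀ u v : Set ℂ, IsClosed u → IsClosed v → D ⊆ u ∪ v → Disjoint u v → x ∈ u →
      D ⊆ u := by
    intro u v hu hv huv hd hxu
    have hdj := Set.disjoint_left.1 hd
    have hxv : x ∉ v := hdj hxu
    have hun : D ∩ u ∪ D ∩ v = D := by
      rw [← Set.inter_union_distrib_left, Set.inter_eq_left]; exact huv
    by_cases hpv : p ∈ v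
    · exfalso
      have := h.prune hρ hρr i (A := D ∩ u) (B := D ∩ v) (hDc.inter hu) (hDc.inter hv) hun
        (fun z hz => absurd hz.2.2 (hdj hz.1.2)) ⟨hxD, hxu⟩ (by
          intro z hz hzρ
          have := hp z ⟨hz.1.1.1, hz.1.2⟩ hzρ
          subst this
          exact hdj hz.2 hpv)
      obtain ⟨ε, hε, hball⟩ := Metric.isOpen_iff.1 hv.isOpen_compl x hxv
      obtain ⟨z, hz, hne, hlt⟩ := h.happ i (min ε ρ) (lt_min hε hρ)
      have hzD : z ∈ D := ⟨⟨hz.1, (hlt.trans_le (min_le_right _ _)).le⟩, hz.2⟩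
      rcases huv hzD with h' | h'
      · exact hne (this ⟨hzD, h'⟩)
      · exact hball (hlt.trans_le (min_le_left _ _)) h'
    · have := h.prune hρ hρr i (A := {x} ∪ D ∩ v) (B := D ∩ u)
        (isClosed_singleton.union (hDc.inter hv)) (hDc.inter hu) (by
          rw [Set.union_assoc, Set.union_comm (D ∩ v), hun, Set.union_eq_right]; exact Set.singleton_subset_iff.2 hxD) (by
          rintro z ⟨hz | hz, hz'⟩
          · exact hz
          · exact absurd hz.2 (hdj hz'.2)) (Or.inl rfl) (by
          rintro z (hz | hz) hzρ
          · rw [Set.mem_singleton_iff.1 hz, dist_self] at hzρ; exact hρ.ne hzρ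
          · have := hp z ⟨hz.1.1.1, hz.1.2⟩ hzρ
            subst this
            exact hpv hz.2)
      intro z hz
      rcases huv hz with h' | h'
      · exact h'
      · have : z = x := this (Or.inr ⟨hz, h'⟩)
        rw [this]; exact hxu
  rw [isPreconnected_iff_subset_of_fully_disjoint_closed hDc]
  intro u v hu hv huv hd
  rcases huv hxD with h' | h'
  · exact Or.inl (key u v hu hv huv hd h')
  · exact Or.inr (key v u hv hu (by rwa [Set.union_comm v]) hd.symm h')

lemma cover (h : StCtx C S x r K) {ρ : ℝ} (hρr : ρ ≤ r) :
    S ∩ Metric.closedBall x ρ = ⋃ i, S ∩ Metric.closedBall x ρ ∩ K i := by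
  rw [← Set.inter_iUnion, eq_comm, Set.inter_eq_left]
  exact fun z hz => h.hcov ⟨hz.1, Metric.closedBall_subset_closedBall hρr hz.2⟩

lemma sum (h : StCtx C S x r K) {ρ : ℝ} (hρr : ρ ≤ r) :
    μH[1] (S ∩ Metric.closedBall x ρ) = ∑ i, μH[1] (S ∩ Metric.closedBall x ρ ∩ K i) := by
  conv_lhs => rw [h.cover hρr]
  rw [measure_iUnion₀, tsum_fintype]
  · intro i j hij
    refine measure_mono_null ?_ (st_single x)
    exact fun z hz => h.hdisj i j hij ⟨hz.1.2, hz.2.2⟩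
  · exact fun i => (h.closedD ρ i).measurableSet.nullMeasurableSet

/-- If each sector meets the circle in one point then locally `S` is a star. -/
lemma star (h : StCtx C S x r K) {ρ : ℝ} (hρ : 0 < ρ) (hρr : ρ ≤ r) {p : Fin 3 → ℂ}
    (hpm : ∀ i, p i ∈ S ∩ K i ∧ dist (p i) x = ρ)
    (hp : ∀ i, ∀ z ∈ S ∩ K i, dist z x = ρ → z = p i) (i : Fin 3) :
    S ∩ Metric.closedBall x ρ ∩ K i = segment ℝ x (p i) := by
  have hup : μH[1] (S ∩ Metric.closedBall x ρ) ≤ ∑ i : Fin 3, ENNReal.ofReal ρ := by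
    refine (st_replace (T := ⋃ i, segment ℝ x (p i)) h.hSc h.hcon h.hCS h.hmin h.hfin h.hx hρ
      ?_ ?_ ?_ ?_).trans ?_
    · refine isClosed_iUnion_of_finite fun i => ?_
      rw [← convexHull_pair]
      exact (Set.toFinite _).isClosed_convexHull ℝ
    · refine ⟨⟨x, Set.mem_iUnion.2 ⟨0, left_mem_segment ℝ _ _⟩⟩, ?_⟩
      exact isPreconnected_iUnion ⟨x, Set.mem_iInter.2 fun i => left_mem_segment ℝ _ _⟩
        fun i => (convex_segment _ _).isPreconnected
    · rintro z ⟨hz, hzρ⟩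
      obtain ⟨j, hj⟩ := Set.mem_iUnion.1 (h.hcov ⟨hz, (Metric.mem_sphere.1 hzρ).le.trans hρr⟩)
      rw [hp j z ⟨hz, hj⟩ hzρ]
      exact Set.mem_iUnion.2 ⟨j, right_mem_segment ℝ _ _⟩
    · rintro c ⟨hc, hcb⟩
      have : c = x := h.hCr ⟨hc, (Metric.mem_ball.1 hcb).le.trans hρr⟩
      rw [this]
      exact Set.mem_iUnion.2 ⟨0, left_mem_segment ℝ _ _⟩
    · refine (measure_iUnion_fintype_le _ _).trans (Finset.sum_le_sum fun i _ => ?_)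
      rw [st_seg, dist_comm, (hpm i).2]
  have hpc := fun i => h.preconn hρ hρr i (hp i)
  have hpD : ∀ i, p i ∈ S ∩ Metric.closedBall x ρ ∩ K i := fun i =>
    ⟨⟨(hpm i).1.1, (hpm i).2.le⟩, (hpm i).1.2⟩
  have hlow : ∀ i, ENNReal.ofReal ρ ≤ μH[1] (S ∩ Metric.closedBall x ρ ∩ K i) := by
    intro i
    have := st_conn (hpc i) (h.xmem hρ i) (hpD i)
    rwa [(hpm i).2] at this
  rw [h.sum hρr] at hup
  refine st_segment (hpc i) (h.xmem hρ i) (hpD i) ?_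
  rw [dist_comm, (hpm i).2]
  by_contra! hlt
  refine absurd hup (not_le.2 ?_)
  rw [← Finset.add_sum_erase _ _ (Finset.mem_univ i), ← Finset.add_sum_erase (f := fun j =>
    μH[1] (S ∩ Metric.closedBall x ρ ∩ K j)) _ (Finset.mem_univ i)]
  refine ENNReal.add_lt_add_of_lt_of_le ?_ hlt (Finset.sum_le_sum fun j _ => hlow j)
  exact (ENNReal.sum_lt_top.2 fun _ _ => ENNReal.ofReal_lt_top).ne

end StCtx

def stCone (x d : ℂ) (κ : ℝ) : Set ℂ := {z | ‖(z - x) - (‖z - x‖ : ℂ) * d‖ ≤ κ * ‖z - x‖}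

lemma stCone_closed (x d : ℂ) (κ : ℝ) : IsClosed (stCone x d κ) := by
  unfold stCone
  exact isClosed_le (by fun_prop) (by fun_prop)

lemma stCone_coord {x d : ℂ} {κ : ℝ} (hd : ‖d‖ = 1) {z : ℂ} (hz : z ∈ stCone x d κ) :
    ∃ w : ℂ, w = (z - x) * (starRingEnd ℂ) d ∧ z = x + d * w ∧ ‖w‖ = ‖z - x‖ ∧
      ‖w - (‖z - x‖ : ℂ)‖ ≤ κ * ‖z - x‖ := by
  have hdd : d * (starRingEnd ℂ) d = 1 := by
    rw [Complex.mul_conj, Complex.normSq_eq_norm_sq, hd]; simp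
  refine ⟨(z - x) * (starRingEnd ℂ) d, rfl, ?_, by simp [hd], ?_⟩
  · linear_combination (x - z) * hdd
  · have : (z - x) * (starRingEnd ℂ) d - (‖z - x‖ : ℂ) =
        ((z - x) - (‖z - x‖ : ℂ) * d) * (starRingEnd ℂ) d := by
      linear_combination (‖z - x‖ : ℂ) * hdd
    rw [this, norm_mul, Complex.norm_conj, hd, mul_one]
    exact hz

lemma stCone_inj {x d : ℂ} {κ ρ : ℝ} (hκ : κ < 1) (hρ : 0 < ρ) (hd : ‖d‖ = 1) {z z' : ℂ}
    (hz : z ∈ stCone x d κ) (hz' : z' ∈ stCone x d κ) (h : dist z x = ρ) (h' : dist z' x = ρ)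
    (him : ((z - x) * (starRingEnd ℂ) d).im = ((z' - x) * (starRingEnd ℂ) d).im) : z = z' := by
  obtain ⟨w, hw, hzw, hn, hk⟩ := stCone_coord hd hz
  obtain ⟨w', hw', hzw', hn', hk'⟩ := stCone_coord hd hz'
  rw [← hw, ← hw'] at him
  rw [dist_eq_norm] at h h'
  rw [h] at hn hk
  rw [h'] at hn' hk'
  have hre : ∀ v : ℂ, ‖v - (ρ : ℂ)‖ ≤ κ * ρ → 0 < v.re := by
    intro v hv
    have := (Complex.abs_re_le_norm _).trans hv
    have := neg_le_of_abs_le this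
    simp only [Complex.sub_re, Complex.ofReal_re] at this
    nlinarith
  have e1 := Complex.sq_norm w
  have e2 := Complex.sq_norm w'
  rw [hn, Complex.normSq_apply] at e1
  rw [hn', Complex.normSq_apply, ← him] at e2
  have hr1 := hre w hk
  have hr2 := hre w' hk'
  have : w = w' := by
    apply Complex.ext _ him
    nlinarith
  rw [hzw, hzw', this]

lemma st_arc {x d : ℂ} {r δ : ℝ} (hd : ‖d‖ = 1) (hr : 0 < r) (_hδ : 0 < δ) :
    μH[1] ((fun θ : ℝ => x + d * (r * Complex.exp (Complex.I * θ))) '' Set.Icc (-δ) δ) ≤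
      ENNReal.ofReal (2 * δ * r) := by
  have hl : LipschitzWith r.toNNReal
      (fun θ : ℝ => x + d * (r * Complex.exp (Complex.I * θ))) := by
    refine LipschitzWith.of_dist_le_mul fun a b => ?_
    have e : x + d * (r * Complex.exp (Complex.I * a)) - (x + d * (r * Complex.exp (Complex.I * b)))
        = d * (r * (Complex.exp (Complex.I * b) * (Complex.exp (Complex.I * (a - b : ℝ)) - 1))) := by
      rw [mul_sub (Complex.exp _), ← Complex.exp_add]
      push_cast
      ring_nf
    have hb : ‖Complex.exp (Complex.I * b)‖ = 1 := Complex.norm_exp_I_mul_ofReal b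
    rw [dist_eq_norm, e, norm_mul, norm_mul, norm_mul, hd, hb, Complex.norm_real, Real.norm_eq_abs,
      abs_of_pos hr, Real.coe_toNNReal _ hr.le, Real.dist_eq, one_mul, one_mul]
    exact mul_le_mul_of_nonneg_left (Real.norm_exp_I_mul_ofReal_sub_one_le) hr.le
  have := hl.hausdorffMeasure_image_le (d := 1) zero_le_one (Set.Icc (-δ) δ)
  rw [hausdorffMeasure_real, Real.volume_Icc] at this
  refine this.trans (le_of_eq ?_)
  rw [ENNReal.rpow_one, ← ENNReal.ofReal, ← ENNReal.ofReal_mul hr.le]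
  congr 1; ring

lemma st_upper {C S : Set ℂ} {x : ℂ} {r κ : ℝ} {d : Fin 3 → ℂ} (hr : 0 < r)
    (hd : ∀ i, ‖d i‖ = 1) (hκ : ∀ w : ℂ, ‖w - 1‖ ≤ κ → |w.arg| ≤ 1 / 12)
    (h : StCtx C S x r (fun i => stCone x (d i) κ)) :
    μH[1] (S ∩ Metric.closedBall x r) ≤ ENNReal.ofReal (7 / 2 * r) := by
  have hcont : ∀ i, Continuous (fun θ : ℝ => x + d i * (r * Complex.exp (Complex.I * θ))) := by
    intro i; fun_prop
  refine (st_replace (T := ⋃ i, (segment ℝ x (x + d i * r) ∪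
    (fun θ : ℝ => x + d i * (r * Complex.exp (Complex.I * θ))) '' Set.Icc (-(1/12)) (1/12)))
    h.hSc h.hcon h.hCS h.hmin h.hfin h.hx hr ?_ ?_ ?_ ?_).trans ?_
  · refine isClosed_iUnion_of_finite fun i => IsClosed.union ?_ ?_
    · rw [← convexHull_pair]
      exact (Set.toFinite _).isClosed_convexHull ℝ
    · exact (isCompact_Icc.image (hcont i)).isClosed
  · refine ⟨⟨x, Set.mem_iUnion.2 ⟨0, Or.inl (left_mem_segment ℝ _ _)⟩⟩, ?_⟩
    refine isPreconnected_iUnion ⟨x, Set.mem_iInter.2 fun i => Or.inl (left_mem_segment ℝ _ _)⟩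
        fun i => ?_
    refine IsPreconnected.union (x + d i * r) (right_mem_segment ℝ _ _) ?_
      (convex_segment _ _).isPreconnected (isPreconnected_Icc.image _ (hcont i).continuousOn)
    exact ⟨0, by norm_num, by simp⟩
  · rintro z ⟨hz, hzr⟩
    obtain ⟨j, hj⟩ := Set.mem_iUnion.1 (h.hcov ⟨hz, (Metric.mem_sphere.1 hzr).le⟩)
    refine Set.mem_iUnion.2 ⟨j, Or.inr ?_⟩
    obtain ⟨w, -, hzw, hn, hk⟩ := stCone_coord (hd j) hj
    rw [Metric.mem_sphere, dist_eq_norm] at hzr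
    rw [hzr] at hn hk
    have hrc : (r : ℂ) ≠ 0 := by exact_mod_cast hr.ne'
    have hw1 : ‖w / r - 1‖ ≤ κ := by
      have : w / r - 1 = (w - r) / r := by field_simp
      rw [this, norm_div, Complex.norm_real, Real.norm_eq_abs, abs_of_pos hr, div_le_iff₀ hr]
      exact hk
    have hw2 : ‖w / r‖ = 1 := by
      rw [norm_div, Complex.norm_real, Real.norm_eq_abs, abs_of_pos hr, hn, div_self hr.ne']
    refine ⟨(w / r).arg, abs_le.1 (hκ _ hw1), ?_⟩
    have := Complex.norm_mul_exp_arg_mul_I (w / r)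
    rw [hw2] at this
    simp only
    rw [mul_comm Complex.I, hzw]
    congr 2
    rw [Complex.ofReal_one, one_mul] at this
    rw [this]; field_simp
  · rintro c ⟨hc, hcb⟩
    have : c = x := h.hCr ⟨hc, (Metric.mem_ball.1 hcb).le⟩
    rw [this]
    exact Set.mem_iUnion.2 ⟨0, Or.inl (left_mem_segment ℝ _ _)⟩
  · refine (measure_iUnion_fintype_le _ _).trans ?_
    have : ∀ i ∈ Finset.univ, μH[1] (segment ℝ x (x + d i * r) ∪
        (fun θ : ℝ => x + d i * (r * Complex.exp (Complex.I * θ))) '' Set.Icc (-(1/12)) (1/12))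
        ≤ ENNReal.ofReal (7 / 6 * r) := by
      intro i _
      refine (measure_union_le _ _).trans ((add_le_add (st_seg _ _).le
        (st_arc (hd i) hr (by norm_num))).trans (le_of_eq ?_))
      have hdd : dist x (x + d i * r) = r := by
        rw [dist_eq_norm]; simp [hd i, abs_of_pos hr]
      rw [hdd, ← ENNReal.ofReal_add hr.le (by positivity)]
      congr 1; ring
    refine (Finset.sum_le_sum this).trans (le_of_eq ?_)
    rw [← ENNReal.ofReal_sum_of_nonneg (fun _ _ => by positivity)]
    congr 1
    simp; ring

lemma st_count {C S : Set ℂ} {x : ℂ} {r κ : ℝ} {d : Fin 3 → ℂ} (hr : 0 < r)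
    (hd : ∀ i, ‖d i‖ = 1) (hκ1 : κ < 1) (hκ : ∀ w : ℂ, ‖w - 1‖ ≤ κ → |w.arg| ≤ 1 / 12)
    (h : StCtx C S x r (fun i => stCone x (d i) κ)) :
    ∃ ρ, 0 < ρ ∧ ρ ≤ r ∧ ∃ p : Fin 3 → ℂ, ∀ i, dist (p i) x = ρ ∧ p i ∈ stCone x (d i) κ ∧
      S ∩ Metric.closedBall x ρ ∩ stCone x (d i) κ = segment ℝ x (p i) := by
  obtain ⟨g, hg⟩ : ∃ g : Fin 3 → ℂ → ℝ, ∀ i z, g i z = ((z - x) * (starRingEnd ℂ) (d i)).im :=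
    ⟨_, fun _ _ => rfl⟩
  have hgc : ∀ i, Continuous (g i) := by
    intro i
    rw [show g i = _ from funext (hg i)]
    fun_prop
  obtain ⟨ρ, hρ, hρr, huniq⟩ : ∃ ρ, 0 < ρ ∧ ρ ≤ r ∧ ∀ i, ∀ z ∈ S ∩ stCone x (d i) κ,
      ∀ w ∈ S ∩ stCone x (d i) κ, dist z x = ρ → dist w x = ρ → ¬ (g i z < g i w) := by
    by_contra! hcon
    have hl : LipschitzWith 1 (fun z : ℂ => dist z x) := LipschitzWith.dist_left x
    have hcomp : ∀ i, IsCompact (S ∩ Metric.closedBall x r ∩ stCone x (d i) κ) := fun i =>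
      (isCompact_closedBall x r).of_isClosed_subset (h.closedD r i) (fun z hz => hz.1.2)
    have h1 := fun i => st_mult (hcomp i) hl (hgc i)
    set E : Fin 3 → Set ℝ := fun i => {t | ∃ z ∈ S ∩ Metric.closedBall x r ∩ stCone x (d i) κ,
      ∃ w ∈ S ∩ Metric.closedBall x r ∩ stCone x (d i) κ, dist z x = t ∧ dist w x = t ∧
      g i z < g i w} with hE
    have h2 : ∀ i, ENNReal.ofReal r ≤
        volume ((fun z : ℂ => dist z x) '' (S ∩ Metric.closedBall x r ∩ stCone x (d i) κ)) := by
      intro i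
      have : ENNReal.ofReal r = volume (Set.Ioc 0 r) := by simp
      rw [this]
      refine measure_mono fun t ht => ?_
      obtain ⟨z, hz, hzt⟩ := h.meet ht.1 ht.2 i
      exact ⟨z, ⟨⟨hz.1, hzt.le.trans ht.2⟩, hz.2⟩, hzt⟩
    have h3 : ENNReal.ofReal r ≤ ∑ i, volume (E i) := by
      have : ENNReal.ofReal r = volume (Set.Ioc 0 r) := by simp
      rw [this]
      refine le_trans (measure_mono ?_) (measure_iUnion_fintype_le _ _)
      intro t ht
      obtain ⟨i, z, hz, w, hw, hzt, hwt, hlt⟩ := hcon t ht.1 ht.2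
      exact Set.mem_iUnion.2 ⟨i, z, ⟨⟨hz.1, hzt.le.trans ht.2⟩, hz.2⟩, w,
        ⟨⟨hw.1, hwt.le.trans ht.2⟩, hw.2⟩, hzt, hwt, hlt⟩
    have h4 : (∑ _i : Fin 3, ENNReal.ofReal r) + ENNReal.ofReal r ≤
        μH[1] (S ∩ Metric.closedBall x r) := by
      rw [h.sum le_rfl]
      refine (add_le_add le_rfl h3).trans ?_
      rw [← Finset.sum_add_distrib]
      exact Finset.sum_le_sum fun i _ => (add_le_add (h2 i) le_rfl).trans (h1 i)
    have h5 := h4.trans (st_upper hr hd hκ h)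
    rw [← ENNReal.ofReal_sum_of_nonneg (fun _ _ => hr.le),
      ← ENNReal.ofReal_add (Finset.sum_nonneg fun _ _ => hr.le) hr.le,
      ENNReal.ofReal_le_ofReal_iff (by positivity)] at h5
    simp at h5
    linarith
  have hmeet := fun i => h.meet hρ hρr i
  choose p hpm hpd using hmeet
  refine ⟨ρ, hρ, hρr, p, fun i => ⟨hpd i, (hpm i).2, ?_⟩⟩
  refine h.star hρ hρr (p := p) (fun i => ⟨hpm i, hpd i⟩) (fun i z hz hzρ => ?_) i
  refine stCone_inj hκ1 hρ (hd i) hz.2 (hpm i).2 hzρ (hpd i) ?_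
  rw [← hg, ← hg]
  exact le_antisymm (not_lt.1 (huniq i _ (hpm i) _ hz (hpd i) hzρ))
    (not_lt.1 (huniq i _ hz _ (hpm i) hzρ (hpd i)))

lemma st_vec {u v : ℂ} (hu : ‖u‖ = 1) (hv : ‖v‖ = 1) (h : -1 / 2 < inner ℝ u v) :
    ∃ t : ℝ, ‖t • (u + v)‖ + ‖u - t • (u + v)‖ + ‖v - t • (u + v)‖ < 2 := by
  have hs : ‖u + v‖ ^ 2 = 2 + 2 * inner ℝ u v := by
    rw [norm_add_sq_real, hu, hv]; ring
  set a := ‖u + v‖ with ha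
  have ha2 : a ≤ 2 := (norm_add_le u v).trans (by rw [hu, hv]; norm_num)
  have ha1 : 1 < a := by
    have : 0 ≤ a := norm_nonneg _
    nlinarith
  have hiu : inner ℝ u (u + v) = a ^ 2 / 2 := by
    rw [inner_add_right, real_inner_self_eq_norm_sq, hu, hs]; ring
  have hiv : inner ℝ v (u + v) = a ^ 2 / 2 := by
    rw [inner_add_right, real_inner_self_eq_norm_sq, hv, hs, real_inner_comm]; ring
  set t : ℝ := (a - 1) / (2 * a) with ht
  have hta : t * a = (a - 1) / 2 := by rw [ht]; field_simp
  have ht0 : 0 < t := by rw [ht]; apply div_pos <;> linarith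
  have ht1 : t ≤ 1 := by nlinarith
  have key : ∀ w : ℂ, ‖w‖ = 1 → inner ℝ w (u + v) = a ^ 2 / 2 →
      ‖w - t • (u + v)‖ ≤ 1 - t * a ^ 2 / 2 + t ^ 2 * a ^ 2 / 2 := by
    intro w hw hi
    have e : ‖w - t • (u + v)‖ ^ 2 = 1 - t * a ^ 2 + t ^ 2 * a ^ 2 := by
      rw [norm_sub_sq_real, inner_smul_right, hi, hw, norm_smul, mul_pow, Real.norm_eq_abs, sq_abs]
      ring
    have hpos : 0 ≤ 1 - t * a ^ 2 / 2 + t ^ 2 * a ^ 2 / 2 := by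
      have : t * a ^ 2 = (a - 1) / 2 * a := by rw [← hta]; ring
      rw [mul_div_assoc] at *
      nlinarith [sq_nonneg (t * a)]
    refine abs_le_of_sq_le_sq' ?_ hpos |>.2
    rw [e]
    nlinarith [sq_nonneg (- t * a ^ 2 / 2 + t ^ 2 * a ^ 2 / 2)]
  refine ⟨t, ?_⟩
  have k1 := key u hu hiu
  have k2 := key v hv hiv
  have k3 : ‖t • (u + v)‖ = t * a := by rw [norm_smul, Real.norm_eq_abs, abs_of_pos ht0]
  have e1 : t * a ^ 2 = (a - 1) / 2 * a := by rw [← hta]; ring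
  have e2 : t ^ 2 * a ^ 2 = ((a - 1) / 2) ^ 2 := by rw [← hta]; ring
  rw [e1, e2] at k1 k2
  rw [k3, hta]
  nlinarith

lemma st_angle {C S : Set ℂ} {x : ℂ} {r ρ : ℝ} {K : Fin 3 → Set ℂ} {d : Fin 3 → ℂ}
    (hd : ∀ i, ‖d i‖ = 1) (h : StCtx C S x r K) (hρ : 0 < ρ) (hρr : ρ ≤ r)
    (hseg : ∀ i, S ∩ Metric.closedBall x ρ ∩ K i = segment ℝ x (x + ρ • d i))
    (i j k : Fin 3) (hijk : ∀ l, l = i ∨ l = j ∨ l = k) : inner ℝ (d i) (d j) ≤ -1 / 2 := by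
  by_contra! hlt
  obtain ⟨t, ht⟩ := st_vec (hd i) (hd j) hlt
  have hL : μH[1] (S ∩ Metric.closedBall x ρ) = ENNReal.ofReal (3 * ρ) := by
    rw [h.sum hρr]
    have : ∀ i, dist x (x + ρ • d i) = ρ := by
      intro i; rw [dist_eq_norm]; simp [hd, abs_of_pos hρ]
    simp_rw [hseg, st_seg, this]
    rw [← ENNReal.ofReal_sum_of_nonneg (fun _ _ => hρ.le)]
    simp
  have hcl : ∀ a b : ℂ, IsClosed (segment ℝ a b) := fun a b => by
    rw [← convexHull_pair]; exact (Set.toFinite _).isClosed_convexHull ℝ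
  set y := x + ρ • (t • (d i + d j)) with hy
  have hpre : ∀ a b : ℂ, IsPreconnected (segment ℝ a b) := fun a b =>
    (convex_segment a b).isPreconnected
  have hT := st_replace (T := (segment ℝ x (x + ρ • d k) ∪ segment ℝ x y) ∪
    (segment ℝ y (x + ρ • d i) ∪ segment ℝ y (x + ρ • d j)))
    h.hSc h.hcon h.hCS h.hmin h.hfin h.hx hρ
    (((hcl _ _).union (hcl _ _)).union ((hcl _ _).union (hcl _ _)))
    ⟨⟨x, Or.inl (Or.inl (left_mem_segment ℝ _ _))⟩, by
      refine IsPreconnected.union y (Or.inr (right_mem_segment ℝ _ _))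
        (Or.inl (left_mem_segment ℝ _ _)) ?_ ?_
      · exact IsPreconnected.union x (left_mem_segment ℝ _ _) (left_mem_segment ℝ _ _)
          (hpre _ _) (hpre _ _)
      · exact IsPreconnected.union y (left_mem_segment ℝ _ _) (left_mem_segment ℝ _ _)
          (hpre _ _) (hpre _ _)⟩
    (by
      rintro z ⟨hz, hzρ⟩
      have hzρ' : dist z x = ρ := hzρ
      obtain ⟨l, hl⟩ := Set.mem_iUnion.1 (h.hcov ⟨hz, hzρ'.le.trans hρr⟩)
      have hzs := (hseg l).subset ⟨⟨hz, hzρ'.le⟩, hl⟩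
      have hzl : z = x + ρ • d l := by
        rw [segment_eq_image'] at hzs
        obtain ⟨s, hs, rfl⟩ := hzs
        rw [dist_eq_norm] at hzρ'
        simp only [add_sub_cancel_left, norm_smul, Real.norm_eq_abs, abs_of_nonneg hs.1,
          abs_of_pos hρ, hd, mul_one] at hzρ'
        have : s = 1 := mul_right_cancel₀ hρ.ne' (hzρ'.trans (one_mul ρ).symm)
        simp [this]
      rcases hijk l with e | e | e <;> rw [hzl, e]
      · exact Or.inr (Or.inl (right_mem_segment ℝ _ _))
      · exact Or.inr (Or.inr (right_mem_segment ℝ _ _))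
      · exact Or.inl (Or.inl (right_mem_segment ℝ _ _)))
    (by
      rintro c ⟨hc, hcb⟩
      have : c = x := h.hCr ⟨hc, (Metric.mem_ball.1 hcb).le.trans hρr⟩
      rw [this]
      exact Or.inl (Or.inl (left_mem_segment ℝ _ _)))
  have hT2 := hT.trans ((measure_union_le _ _).trans (add_le_add (measure_union_le _ _)
    (measure_union_le _ _)))
  have e1 : dist x (x + ρ • d k) = ρ := by rw [dist_eq_norm]; simp [hd, abs_of_pos hρ]
  have e2 : dist x y = ρ * ‖t • (d i + d j)‖ := by
    rw [hy, dist_comm, dist_eq_norm, add_sub_cancel_left, norm_smul, Real.norm_eq_abs,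
      abs_of_pos hρ]
  have e3 : ∀ l, dist y (x + ρ • d l) = ρ * ‖d l - t • (d i + d j)‖ := by
    intro l
    rw [hy, dist_comm, dist_eq_norm, add_sub_add_left_eq_sub, ← smul_sub, norm_smul,
      Real.norm_eq_abs, abs_of_pos hρ]
  rw [st_seg, st_seg, st_seg, st_seg, hL, ← ENNReal.ofReal_add dist_nonneg dist_nonneg,
    ← ENNReal.ofReal_add dist_nonneg dist_nonneg, ← ENNReal.ofReal_add (by positivity)
    (by positivity), ENNReal.ofReal_le_ofReal_iff (by positivity), e1, e2, e3, e3] at hT2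
  nlinarith

lemma st_angles {u v w : ℂ} (hu : ‖u‖ = 1) (hv : ‖v‖ = 1) (hw : ‖w‖ = 1)
    (h1 : inner ℝ u v ≤ -1 / 2) (h2 : inner ℝ u w ≤ -1 / 2) (h3 : inner ℝ v w ≤ -1 / 2) :
    InnerProductGeometry.angle u v = 2 * Real.pi / 3 ∧
    InnerProductGeometry.angle u w = 2 * Real.pi / 3 ∧
    InnerProductGeometry.angle v w = 2 * Real.pi / 3 := by
  have h0 : 0 ≤ ‖u + v + w‖ ^ 2 := sq_nonneg _
  rw [norm_add_sq_real, norm_add_sq_real, inner_add_left, hu, hv, hw] at h0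
  have hc : Real.cos (2 * Real.pi / 3) = -1 / 2 := by
    rw [show 2 * Real.pi / 3 = Real.pi - Real.pi / 3 by ring, Real.cos_pi_sub, Real.cos_pi_div_three]
    norm_num
  have key : ∀ a b : ℂ, ‖a‖ = 1 → ‖b‖ = 1 → inner ℝ a b = -1 / 2 →
      InnerProductGeometry.angle a b = 2 * Real.pi / 3 := by
    intro a b ha hb hab
    unfold InnerProductGeometry.angle
    rw [ha, hb, hab, mul_one, div_one, ← hc, Real.arccos_cos] <;> linarith [Real.pi_pos]
  exact ⟨key u v hu hv (by linarith), key u w hu hw (by linarith), key v w hv hw (by linarith)⟩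

lemma stCone_of_unit {x d z : ℂ} {κ : ℝ} (hz : z ≠ x)
    (h : ‖‖z - x‖⁻¹ • (z - x) - d‖ ≤ κ) : z ∈ stCone x d κ := by
  have hp : 0 < ‖z - x‖ := norm_pos_iff.2 (sub_ne_zero.2 hz)
  have hc : (‖z - x‖ : ℂ) ≠ 0 := by exact_mod_cast hp.ne'
  have e : (z - x) - (‖z - x‖ : ℂ) * d = (‖z - x‖ : ℂ) * (‖z - x‖⁻¹ • (z - x) - d) := by
    rw [Complex.real_smul]; push_cast; field_simp
  change ‖(z - x) - (‖z - x‖ : ℂ) * d‖ ≤ κ * ‖z - x‖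
  rw [e, norm_mul, Complex.norm_real, norm_norm, mul_comm]
  exact mul_le_mul_of_nonneg_right h hp.le

lemma stCone_self (x d : ℂ) (κ : ℝ) : x ∈ stCone x d κ := by simp [stCone]

lemma st_cover {S : Set ℂ} {x : ℂ} {d : Fin 3 → ℂ} {κ : ℝ} (hκ : 0 < κ)
    (hall : ∀ e, IsTangentDir S x e → ∃ i, e = d i) :
    ∃ r > 0, S ∩ Metric.closedBall x r ⊆ ⋃ i, stCone x (d i) κ := by
  by_contra! hcon
  have hn : ∀ n : ℕ, ∃ z, z ∈ S ∧ dist z x ≤ 1 / ((n : ℝ) + 1) ∧ ∀ i, z ∉ stCone x (d i) κ := by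
    intro n
    obtain ⟨z, hz, hz'⟩ := Set.not_subset.1 (hcon (1 / ((n : ℝ) + 1)) (by positivity))
    exact ⟨z, hz.1, hz.2, fun i hi => hz' (Set.mem_iUnion.2 ⟨i, hi⟩)⟩
  choose f hfS hfd hfK using hn
  have hne : ∀ n, f n ≠ x := fun n he => hfK n 0 (he ▸ stCone_self _ _ _)
  have hft : Filter.Tendsto f Filter.atTop (nhds x) :=
    tendsto_iff_dist_tendsto_zero.2 (squeeze_zero (fun _ => dist_nonneg) hfd
      tendsto_one_div_add_atTop_nhds_zero_nat)
  have hu : ∀ n, ‖f n - x‖⁻¹ • (f n - x) ∈ Metric.sphere (0 : ℂ) 1 := by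
    intro n
    have : ‖f n - x‖ ≠ 0 := norm_ne_zero_iff.2 (sub_ne_zero.2 (hne n))
    rw [mem_sphere_zero_iff_norm, norm_smul, norm_inv, norm_norm, inv_mul_cancel₀ this]
  obtain ⟨e, he, φ, hφ, hlim⟩ := (isCompact_sphere (0 : ℂ) 1).tendsto_subseq hu
  obtain ⟨i, hi⟩ := hall e ⟨mem_sphere_zero_iff_norm.1 he, f ∘ φ, fun n => ⟨hfS _, hne _⟩,
    hft.comp hφ.tendsto_atTop, hlim⟩
  obtain ⟨n, hn⟩ := (hlim.eventually (Metric.ball_mem_nhds e hκ)).exists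
  refine hfK (φ n) i (stCone_of_unit (hne _) ?_)
  rw [← hi, ← dist_eq_norm]
  exact (Metric.mem_ball.1 hn).le

lemma st_app {S : Set ℂ} {x d : ℂ} {κ : ℝ} (hκ : 0 < κ) (h : IsTangentDir S x d) :
    ∀ ρ > 0, ∃ z ∈ S ∩ stCone x d κ, z ≠ x ∧ dist z x < ρ := by
  intro ρ hρ
  obtain ⟨_, f, hf, hft, hfl⟩ := h
  obtain ⟨n, h1, h2⟩ := ((hfl.eventually (Metric.ball_mem_nhds d hκ)).and
    (hft.eventually (Metric.ball_mem_nhds x hρ))).exists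
  refine ⟨f n, ⟨(hf n).1, stCone_of_unit (hf n).2 ?_⟩, (hf n).2, h2⟩
  rw [← dist_eq_norm]
  exact (Metric.mem_ball.1 h1).le

lemma st_fin {C S : Set ℂ} (hC : C.Finite) (x : ℂ)
    (hmin : ∀ S' : Set ℂ, IsClosed S' → IsConnected S' → C ⊆ S' → μH[1] S ≤ μH[1] S') :
    μH[1] S ≠ ⊤ := by
  set T : Set ℂ := ⋃ c ∈ insert x C, segment ℝ x c with hT
  have hf : (insert x C).Finite := hC.insert x
  have h1 : IsClosed T := hf.isClosed_biUnion fun c _ => by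
    rw [← convexHull_pair]; exact (Set.toFinite _).isClosed_convexHull ℝ
  have h2 : IsPreconnected T := by
    rw [hT, Set.biUnion_eq_iUnion]
    exact isPreconnected_iUnion ⟨x, Set.mem_iInter.2 fun i => left_mem_segment ℝ _ _⟩
      fun i => (convex_segment _ _).isPreconnected
  have hm : ∀ c ∈ insert x C, c ∈ T := fun c hc =>
    Set.mem_biUnion hc (right_mem_segment ℝ _ _)
  have h3 := hmin T h1 ⟨⟨x, hm x (Or.inl rfl)⟩, h2⟩ fun c hc => hm c (Or.inr hc)
  refine (h3.trans_lt ?_).ne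
  exact measure_biUnion_lt_top hf fun c _ => by rw [st_seg]; exact ENNReal.ofReal_lt_top

lemma st_main {C S : Set ℂ} (hC : C.Finite) (hSc : IsClosed S)
    (hScon : IsConnected S) (hCS : C ⊆ S)
    (hmin : ∀ S' : Set ℂ, IsClosed S' → IsConnected S' → C ⊆ S' → μH[1] S ≤ μH[1] S')
    {x : ℂ} (hx : x ∈ S) {d : Fin 3 → ℂ} (hinj : Function.Injective d)
    (ht : ∀ i, IsTangentDir S x (d i)) (hall : ∀ e, IsTangentDir S x e → ∃ i, e = d i) :
    ∃ ε > (0 : ℝ), (∀ i j k : Fin 3, (∀ l, l = i ∨ l = j ∨ l = k) →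
      inner ℝ (d i) (d j) ≤ -1 / 2) ∧
      S ∩ Metric.closedBall x ε = ⋃ i, segment ℝ x (x + ε • d i) := by
  have hd : ∀ i, ‖d i‖ = 1 := fun i => (ht i).1
  obtain ⟨κ, hκ0, hκ1, hκa, hκd⟩ : ∃ κ : ℝ, 0 < κ ∧ κ < 1 ∧
      (∀ w : ℂ, ‖w - 1‖ ≤ κ → |w.arg| ≤ 1 / 12) ∧ ∀ i j, i ≠ j → 2 * κ < ‖d i - d j‖ := by
    have hc : ContinuousAt Complex.arg 1 := Complex.continuousAt_arg (by simp)
    obtain ⟨κ₀, h0, h1⟩ := Metric.continuousAt_iff.1 hc (1 / 12) (by norm_num)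
    have a1 : ∀ᶠ κ : ℝ in nhdsWithin 0 (Set.Ioi 0), κ < 1 ∧ κ < κ₀ ∧
        ∀ i j, i ≠ j → κ < ‖d i - d j‖ / 2 := by
      refine Filter.Eventually.filter_mono nhdsWithin_le_nhds ?_
      refine (gt_mem_nhds one_pos).and ((gt_mem_nhds h0).and ?_)
      refine Filter.eventually_all.2 fun i => Filter.eventually_all.2 fun j => ?_
      by_cases hij : i = j
      · exact Filter.Eventually.of_forall fun _ h => absurd hij h
      · have : 0 < ‖d i - d j‖ := norm_pos_iff.2 (sub_ne_zero.2 fun h => hij (hinj h))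
        filter_upwards [gt_mem_nhds (half_pos this)] with κ h _ using h
    obtain ⟨κ, ⟨b1, b2, b3⟩, b4⟩ := (a1.and self_mem_nhdsWithin).exists
    refine ⟨κ, b4, b1, fun w hw => ?_, fun i j hij => by linarith [b3 i j hij]⟩
    have := h1 (x := w) (by rw [dist_eq_norm]; linarith)
    simp only [Complex.arg_one, dist_zero_right, Real.norm_eq_abs] at this
    exact this.le
  obtain ⟨r₁, hr₁, hcov⟩ := st_cover hκ0 hall
  obtain ⟨r₂, hr₂, hCr⟩ : ∃ r > 0, C ∩ Metric.closedBall x r ⊆ {x} := by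
    have hcl : IsClosed (C \ {x}) := (hC.subset Set.sdiff_subset).isClosed
    obtain ⟨ε, hε, hb⟩ := Metric.nhds_basis_closedBall.mem_iff.1
      (hcl.isOpen_compl.mem_nhds (x := x) (by simp))
    refine ⟨ε, hε, fun c hc => ?_⟩
    by_contra hcx
    exact hb hc.2 ⟨hc.1, hcx⟩
  have hr : 0 < min r₁ r₂ := lt_min hr₁ hr₂
  have hdisj : ∀ i j, i ≠ j → stCone x (d i) κ ∩ stCone x (d j) κ ⊆ {x} := by
    rintro i j hij z ⟨hz1, hz2⟩
    by_contra hzx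
    have hp : 0 < ‖z - x‖ := norm_pos_iff.2 (sub_ne_zero.2 hzx)
    have hz1' : ‖(z - x) - (‖z - x‖ : ℂ) * d i‖ ≤ κ * ‖z - x‖ := hz1
    have hz2' : ‖(z - x) - (‖z - x‖ : ℂ) * d j‖ ≤ κ * ‖z - x‖ := hz2
    have e : (‖z - x‖ : ℂ) * (d i - d j) = ((z - x) - (‖z - x‖ : ℂ) * d j) -
      ((z - x) - (‖z - x‖ : ℂ) * d i) := by ring
    have h1 : ‖z - x‖ * ‖d i - d j‖ ≤ κ * ‖z - x‖ + κ * ‖z - x‖ := by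
      have := norm_sub_le ((z - x) - (‖z - x‖ : ℂ) * d j) ((z - x) - (‖z - x‖ : ℂ) * d i)
      rw [← e, norm_mul, Complex.norm_real, norm_norm] at this
      linarith
    nlinarith [hκd i j hij]
  have ctx : StCtx C S x (min r₁ r₂) (fun i => stCone x (d i) κ) :=
    { hSc := hSc, hcon := hScon.2, hCS := hCS, hmin := hmin, hfin := st_fin hC x hmin, hx := hx
      hK := fun i => stCone_closed _ _ _
      hxK := fun i => stCone_self _ _ _
      hdisj := hdisj
      hcov := (Set.inter_subset_inter_right _
        (Metric.closedBall_subset_closedBall (min_le_left _ _))).trans hcov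
      hCr := (Set.inter_subset_inter_right _
        (Metric.closedBall_subset_closedBall (min_le_right _ _))).trans hCr
      happ := fun i => st_app hκ0 (ht i) }
  obtain ⟨ρ, hρ, hρr, p, hp⟩ := st_count hr hd hκ1 hκa ctx
  have hpd : ∀ i, p i = x + ρ • d i := by
    intro i
    obtain ⟨hpx, hpK, hseg⟩ := hp i
    have hpn : ‖p i - x‖ = ρ := by rw [← dist_eq_norm, hpx]
    have hpne : p i ≠ x := by
      intro h; rw [h, dist_self] at hpx; exact hρ.ne hpx
    have htan : IsTangentDir S x (ρ⁻¹ • (p i - x)) := by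
      refine ⟨by rw [norm_smul, hpn, Real.norm_eq_abs, abs_of_pos (inv_pos.2 hρ),
        inv_mul_cancel₀ hρ.ne'], fun n => x + (1 / ((n : ℝ) + 1)) • (p i - x), fun n => ⟨?_, ?_⟩,
        ?_, ?_⟩
      · refine (hseg.symm.subset ?_).1.1
        rw [segment_eq_image']
        refine ⟨1 / ((n : ℝ) + 1), ⟨by positivity, ?_⟩, rfl⟩
        rw [div_le_one (by positivity)]
        linarith [n.cast_nonneg (α := ℝ)]
      · intro h
        have := add_eq_left.1 h
        rcases smul_eq_zero.1 this with h' | h'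
        · have : (0 : ℝ) < 1 / ((n : ℝ) + 1) := by positivity
          exact this.ne' h'
        · exact hpne (sub_eq_zero.1 h')
      · have := (tendsto_one_div_add_atTop_nhds_zero_nat (𝕜 := ℝ)).smul_const (p i - x)
        simpa using this.const_add x
      · refine tendsto_const_nhds.congr fun n => ?_
        have : (0 : ℝ) < 1 / ((n : ℝ) + 1) := by positivity
        rw [add_sub_cancel_left, norm_smul, hpn, Real.norm_eq_abs, abs_of_pos this, smul_smul]
        congr 1
        field_simp
    obtain ⟨j, hj⟩ := hall _ htan
    have hpj : p i = x + ρ • d j := by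
      rw [← hj, smul_smul, mul_inv_cancel₀ hρ.ne', one_smul]; ring
    by_cases hij : i = j
    · rw [hij] at hpj ⊢; exact hpj
    · exfalso
      refine hpne (hdisj i j hij ⟨hpK, stCone_of_unit hpne ?_⟩)
      rw [hpn, hj, sub_self, norm_zero]
      exact hκ0.le
  have hseg : ∀ i, S ∩ Metric.closedBall x ρ ∩ stCone x (d i) κ = segment ℝ x (x + ρ • d i) :=
    fun i => by rw [(hp i).2.2, hpd i]
  refine ⟨ρ, hρ, fun i j k hl => st_angle hd ctx hρ hρr hseg i j k hl, ?_⟩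
  rw [ctx.cover hρr]
  exact Set.iUnion_congr hseg

/-- Let S be a Steiner tree for a finite set C (a closed connected set of
minimal one-dimensional Hausdorff measure containing C). If x ∈ S has degree 3
(exactly three tangent directions), then locally near x the set S is the union
of three segments meeting at x with pairwise angles exactly 2π/3. -/
theorem stmt_15 (C S : Set ℂ) (hC : C.Finite) (hSc : IsClosed S)
    (hScon : IsConnected S) (hCS : C ⊆ S)
    (hmin : ∀ S' : Set ℂ, IsClosed S' → IsConnected S' → C ⊆ S' →
      μH[1] S ≤ μH[1] S')
    (x : ℂ) (hx : x ∈ S) (d₁ d₂ d₃ : ℂ)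
    (hd : d₁ ≠ d₂ ∧ d₁ ≠ d₃ ∧ d₂ ≠ d₃)
    (h₁ : IsTangentDir S x d₁) (h₂ : IsTangentDir S x d₂)
    (h₃ : IsTangentDir S x d₃)
    (hall : ∀ d, IsTangentDir S x d → d = d₁ ∨ d = d₂ ∨ d = d₃) :
    ∃ ε > (0 : ℝ),
      InnerProductGeometry.angle d₁ d₂ = 2 * Real.pi / 3 ∧
      InnerProductGeometry.angle d₁ d₃ = 2 * Real.pi / 3 ∧
      InnerProductGeometry.angle d₂ d₃ = 2 * Real.pi / 3 ∧
      S ∩ Metric.closedBall x ε =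
        segment ℝ x (x + ε • d₁) ∪ segment ℝ x (x + ε • d₂) ∪
          segment ℝ x (x + ε • d₃) := by
  have hinj : Function.Injective ![d₁, d₂, d₃] := by
    intro i j hij
    fin_cases i <;> fin_cases j <;> simp_all [eq_comm]
  obtain ⟨ε, hε, hang, hS⟩ := st_main hC hSc hScon hCS hmin hx (d := ![d₁, d₂, d₃]) hinj
    (by intro i; fin_cases i; exacts [h₁, h₂, h₃])
    (by
      intro e he
      rcases hall e he with h | h | h
      · exact ⟨0, h⟩
      · exact ⟨1, h⟩
      · exact ⟨2, h⟩)
  have a12 := hang 0 1 2 (by decide)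
  have a13 := hang 0 2 1 (by decide)
  have a23 := hang 1 2 0 (by decide)
  obtain ⟨b1, b2, b3⟩ := st_angles h₁.1 h₂.1 h₃.1 a12 a13 a23
  refine ⟨ε, hε, b1, b2, b3, ?_⟩
  rw [hS]
  ext z
  simp [Set.mem_iUnion, Fin.exists_fin_succ, or_assoc]
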